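/- arXiv:1803.07225 — 2 statements merged into one kernel-verified Lean document; each statement's English description precedes it below -/
import Mathlib

section
/- The function lse₀⁺ : ℝ^d → ℝ defined by lse₀⁺(x) = log(1 + Σ_{i=1}^d exp(x_i)) is strictly convex on ℝ^d (for every d ≥ 1). -/
/-- Strict convexity of log-sum-exp along segments whose direction is not constant. -/
theorem log_sum_exp_lt_of_exists_sub_ne {ι : Type*} [Fintype ι] {x y : ι → ℝ} {a b : ℝ}
    (ha : 0 < a) (hb : 0 < b) (hab : a + b = 1) (hxy : ∃ i j, x i - y i ≠ x j - y j) :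
    Real.log (∑ i, Real.exp (a * x i + b * y i)) <
      a * Real.log (∑ i, Real.exp (x i)) + b * Real.log (∑ i, Real.exp (y i)) := by
  have : Nonempty ι := ⟨hxy.choose⟩
  have sum_exp_pos (z : ι → ℝ) : 0 < ∑ i, Real.exp (z i) :=
    Finset.sum_pos (fun i _ => Real.exp_pos _) Finset.univ_nonempty
  have sum_exp_sub_log (z : ι → ℝ) :
      ∑ i, Real.exp (z i - Real.log (∑ j, Real.exp (z j))) = 1 := by
    simp_rw [Real.exp_sub, Real.exp_log (sum_exp_pos z)]
    rw [← Finset.sum_div, div_self (sum_exp_pos z).ne']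
  have hx := sum_exp_sub_log x
  have hy := sum_exp_sub_log y
  set α := Real.log (∑ i, Real.exp (x i))
  set β := Real.log (∑ i, Real.exp (y i))
  obtain ⟨k, hk⟩ : ∃ k, x k - α ≠ y k - β := by
    by_contra! h
    obtain ⟨i, j, hij⟩ := hxy
    exact hij (by linarith [h i, h j])
  have hlt : ∑ i, Real.exp (a * (x i - α) + b * (y i - β)) <
      ∑ i, (a * Real.exp (x i - α) + b * Real.exp (y i - β)) :=
    Finset.sum_lt_sum
      (fun i _ => convexOn_exp.2 (Set.mem_univ _) (Set.mem_univ _) ha.le hb.le hab)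
      ⟨k, Finset.mem_univ _,
        strictConvexOn_exp.2 (Set.mem_univ _) (Set.mem_univ _) hk ha hb hab⟩
  rw [Finset.sum_add_distrib, ← Finset.mul_sum, ← Finset.mul_sum, hx, hy, mul_one, mul_one,
    hab] at hlt
  rw [Real.log_lt_iff_lt_exp (sum_exp_pos _)]
  have hfactor (i : ι) : Real.exp (a * (x i - α) + b * (y i - β)) =
      Real.exp (a * x i + b * y i) / Real.exp (a * α + b * β) := by
    rw [← Real.exp_sub]
    ring_nf
  simpa only [hfactor, ← Finset.sum_div, div_lt_one (Real.exp_pos _)] using hlt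

/-- The function `lse₀⁺(x) = log (1 + ∑ i, exp (x i))` is strictly convex on `ℝ^d`
for every `d ≥ 1`. -/
theorem lse0p_strictConvexOn (d : ℕ) (hd : 1 ≤ d) :
    StrictConvexOn ℝ (Set.univ : Set (Fin d → ℝ))
      (fun x : Fin d → ℝ => Real.log (1 + ∑ i, Real.exp (x i))) := by
  refine ⟨convex_univ, fun x _ y _ hne a b ha hb hab => ?_⟩
  obtain ⟨k, hk⟩ := Function.ne_iff.1 hne
  have h := log_sum_exp_lt_of_exists_sub_ne (x := fun i : Option (Fin d) => i.elim 0 x)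
    (y := fun i => i.elim 0 y) ha hb hab ⟨some k, none, by simpa [sub_eq_zero] using hk⟩
  simpa [Fintype.sum_option] using h
end

section
/- Let E be a real normed vector space, F : E → ℝ a function, and p, q ∈ E. If F is Fréchet differentiable at p, then lim_{α → 0⁺} J_F^α(p : q)/α = B_F(q : p), where J_F^α(p : q) := (1−α)F(p) + αF(q) − F((1−α)p + αq) and B_F(q : p) := F(q) − F(p) − ⟨q − p, ∇F(p)⟩ (with ⟨·, ∇F(p)⟩ denoting the differential of F at p). -/
open Filter

/-- The skew `α`-Jensen divergence tends to the Bregman divergence: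
if `F` is Fréchet differentiable at `p`, then
`J_F^α(p:q)/α → B_F(q:p) = F(q) − F(p) − dF_p(q − p)` as `α → 0⁺`, where
`J_F^α(p:q) = (1−α)F(p) + αF(q) − F((1−α)p + αq)`. -/
theorem skew_jensen_tendsto_bregman {E : Type*} [NormedAddCommGroup E] [NormedSpace ℝ E]
    (F : E → ℝ) (p q : E) (hF : DifferentiableAt ℝ F p) :
    Tendsto (fun α : ℝ => ((1 - α) * F p + α * F q - F ((1 - α) • p + α • q)) / α)
      (nhdsWithin 0 (Set.Ioi 0)) (nhds (F q - F p - fderiv ℝ F p (q - p))) := by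
  have hslope := (hF.hasFDerivAt.hasLineDerivAt (q - p)).tendsto_slope_zero_right
  refine (hslope.const_sub (F q - F p)).congr' ?_
  filter_upwards [self_mem_nhdsWithin] with α hα
  have hα0 : α ≠ 0 := (Set.mem_Ioi.mp hα).ne'
  have hpoint : (1 - α) • p + α • q = p + α • (q - p) := by module
  rw [hpoint, smul_eq_mul]
  field_simp
  ring
end
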